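/- arXiv:2303.10354 — 5 statements merged into one kernel-verified Lean document; each statement's English description precedes it below -/
import Mathlib

section
/- For every real k with 0 < k < 1 and every real x with 0 ≤ x ≤ 1, the incomplete elliptic integral of the second kind satisfies E(x, k) = −Σ_{n=0}^∞ ((2n)! / (2^{2n} (n!)² (2n − 1))) · k^{2n} · I_{2n}(x), where the series converges (the n = 0 term carries the factor 1/(2·0 − 1) = −1). -/
open MeasureTheory Real Filter Set Topology

/-- `I_{2n}(x) = ∫_0^x t^{2n}/√(1 - t²) dt`. -/
noncomputable def I2n (n : ℕ) (x : ℝ) : ℝ :=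
  ∫ t in (0:ℝ)..x, t ^ (2 * n) / Real.sqrt (1 - t ^ 2)

/-- Incomplete elliptic integral of the first kind `F(x,k)`. -/
noncomputable def ellF (x k : ℝ) : ℝ :=
  ∫ t in (0:ℝ)..x, 1 / Real.sqrt ((1 - t ^ 2) * (1 - k ^ 2 * t ^ 2))

/-- Incomplete elliptic integral of the second kind `E(x,k)`. -/
noncomputable def ellE (x k : ℝ) : ℝ :=
  ∫ t in (0:ℝ)..x, Real.sqrt ((1 - k ^ 2 * t ^ 2) / (1 - t ^ 2))

/-- Complete elliptic integral of the first kind `K(k)`. -/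
noncomputable def ellK (k : ℝ) : ℝ := ellF 1 k

/-- Complete elliptic integral of the second kind `E(k)`. -/
noncomputable def ellEc (k : ℝ) : ℝ := ellE 1 k

/-- Complementary complete elliptic integral of the first kind `K'(k)`. -/
noncomputable def ellK' (k : ℝ) : ℝ := ellK (Real.sqrt (1 - k ^ 2))

/-- Complementary complete elliptic integral of the second kind `E'(k)`. -/
noncomputable def ellE' (k : ℝ) : ℝ := ellEc (Real.sqrt (1 - k ^ 2))

/-- The coefficients of the binomial series of `√(1 - y)`. -/
theorem neg_one_pow_mul_choose_half (n : ℕ) :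
    (-1) ^ n * Ring.choose (1 / 2 : ℝ) n =
      -((Nat.factorial (2 * n) : ℝ) /
        (2 ^ (2 * n) * (Nat.factorial n : ℝ) ^ 2 * (2 * (n : ℝ) - 1))) := by
  have hodd (m : ℕ) : 2 * (m : ℝ) - 1 ≠ 0 := by
    intro h
    have h' : 2 * (m : ℤ) = 1 := by exact_mod_cast sub_eq_zero.mp h
    omega
  induction n with
  | zero => norm_num
  | succ n ih =>
    have hrec : ((n : ℝ) + 1) * Ring.choose (1 / 2 : ℝ) (n + 1) =
        Ring.choose (1 / 2 : ℝ) n * (1 / 2 - n) := by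
      rw [Ring.choose_eq_smul, Ring.choose_eq_smul, descPochhammer_succ_right,
        Polynomial.smeval_mul, Nat.factorial_succ]
      simp [Polynomial.smeval_sub, Polynomial.smeval_natCast]
      field_simp
    have hfac : (Nat.factorial (2 * (n + 1)) : ℝ) =
        (2 * n + 2) * (2 * n + 1) * Nat.factorial (2 * n) := by
      rw [show 2 * (n + 1) = 2 * n + 1 + 1 by ring, Nat.factorial_succ, Nat.factorial_succ]
      push_cast
      ring
    have hn : (n : ℝ) + 1 ≠ 0 := by positivity
    have hn' := hodd n
    have hn'' : 2 * (n : ℝ) + 1 ≠ 0 := by positivity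
    have hf : (Nat.factorial n : ℝ) ≠ 0 := by positivity
    apply mul_left_cancel₀ hn
    calc ((n : ℝ) + 1) * ((-1) ^ (n + 1) * Ring.choose (1 / 2 : ℝ) (n + 1))
        = (-1) ^ (n + 1) * (((n : ℝ) + 1) * Ring.choose (1 / 2 : ℝ) (n + 1)) := by ring
      _ = ((-1) ^ n * Ring.choose (1 / 2 : ℝ) n) * (n - 1 / 2) := by rw [hrec]; ring
      _ = _ := by
        rw [ih, hfac, Nat.factorial_succ, show 2 * (n + 1) = 2 * n + 2 by ring, pow_add]
        push_cast
        rw [show 2 * ((n : ℝ) + 1) - 1 = 2 * n + 1 by ring]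
        field_simp

/-- The binomial series of `√(1 - y)`. -/
theorem hasSum_sqrt_one_sub {y : ℝ} (hy : |y| < 1) :
    HasSum
      (fun n : ℕ =>
        -((Nat.factorial (2 * n) : ℝ) /
          (2 ^ (2 * n) * (Nat.factorial n : ℝ) ^ 2 * (2 * (n : ℝ) - 1))) * y ^ n)
      (Real.sqrt (1 - y)) := by
  have h := (Real.one_add_rpow_hasFPowerSeriesOnBall_zero (a := 1 / 2)).hasSum
    (y := -y) (by simpa [enorm_eq_nnnorm, ← NNReal.coe_lt_coe] using! hy)
  rw [Real.sqrt_eq_rpow]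
  convert! h using 1
  · ext n
    rw [← neg_one_pow_mul_choose_half]
    simp [binomialSeries, neg_pow y]
    ring
  · ring_nf

/-- series expansion of the incomplete elliptic integral of the second kind. -/
theorem stmt_5 (k : ℝ) (hk0 : 0 < k) (hk1 : k < 1) (x : ℝ) (hx0 : 0 ≤ x) (hx1 : x ≤ 1) :
    HasSum
      (fun n : ℕ =>
        -(((Nat.factorial (2 * n) : ℝ) /
            (2 ^ (2 * n) * (Nat.factorial n : ℝ) ^ 2 * (2 * (n : ℝ) - 1)))
          * k ^ (2 * n) * I2n n x))
      (ellE x k) := by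
  simp only [← neg_mul]
  simp only [ellE, I2n, ← intervalIntegral.integral_const_mul]
  set c : ℕ → ℝ := fun n => -((Nat.factorial (2 * n) : ℝ) /
    (2 ^ (2 * n) * (Nat.factorial n : ℝ) ^ 2 * (2 * (n : ℝ) - 1)))
  have hksq : |k ^ 2| < 1 := by
    rw [abs_of_nonneg (sq_nonneg k)]
    nlinarith
  have hsum : Summable fun n => |c n| * k ^ (2 * n) := by
    refine (hasSum_sqrt_one_sub hksq).summable.abs.congr fun n => ?_
    rw [abs_mul, ← pow_mul, abs_of_nonneg (by positivity : 0 ≤ k ^ (2 * n))]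
  have hmem {t : ℝ} (ht : t ∈ uIoc 0 x) : 0 ≤ t ∧ t ≤ 1 := by
    rw [uIoc_of_le hx0] at ht
    exact ⟨ht.1.le, ht.2.trans hx1⟩
  refine intervalIntegral.hasSum_integral_of_dominated_convergence
    (fun n t => |c n| * k ^ (2 * n) * (Real.sqrt (1 - t ^ 2))⁻¹) (fun n => ?_)
    (fun n => .of_forall fun t ht => ?_) (.of_forall fun t _ => hsum.mul_right _) ?_
    (.of_forall fun t ht => ?_)
  · exact Measurable.aestronglyMeasurable (by fun_prop)
  · obtain ⟨ht0, ht1⟩ := hmem ht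
    change ‖c n * k ^ (2 * n) * (t ^ (2 * n) / Real.sqrt (1 - t ^ 2))‖ ≤ _
    rw [Real.norm_eq_abs, abs_mul, abs_mul, abs_of_nonneg (by positivity : 0 ≤ k ^ (2 * n)),
      abs_of_nonneg (by positivity : 0 ≤ t ^ (2 * n) / Real.sqrt (1 - t ^ 2)), div_eq_mul_inv]
    gcongr
    exact mul_le_of_le_one_left (by positivity) (pow_le_one₀ ht0 ht1)
  · simp only [tsum_mul_right]
    refine IntervalIntegrable.const_mul ?_ _
    have hsub : uIcc 0 x ⊆ uIcc (-1) 1 := by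
      rw [uIcc_of_le hx0, uIcc_of_le (by norm_num)]
      exact Icc_subset_Icc (by norm_num) hx1
    simp only [← Real.sqrt_inv]
    exact Polynomial.Chebyshev.intervalIntegrable_sqrt_one_sub_sq_inv.mono_set hsub
  · obtain ⟨ht0, ht1⟩ := hmem ht
    have hkt : k ^ 2 * t ^ 2 < 1 := by
      have : t ^ 2 ≤ 1 := pow_le_one₀ ht0 ht1
      nlinarith [sq_nonneg k]
    have h := (hasSum_sqrt_one_sub (y := k ^ 2 * t ^ 2)
      (by rwa [abs_of_nonneg (by positivity)])).div_const (Real.sqrt (1 - t ^ 2))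
    rw [← Real.sqrt_div (by linarith)] at h
    refine h.congr_fun fun n => ?_
    rw [mul_pow, ← pow_mul, ← pow_mul]
    ring
end

section
/- For every real k with 0 < k < 1, the complete elliptic integral of the first kind satisfies K(k) = (π/2) · Σ_{n=0}^∞ ((2n)! / (2^{2n} (n!)²))² · k^{2n}, where the series converges. -/
open MeasureTheory Real Filter Set Topology

/-- The normalized central binomial coefficient satisfies the Wallis recurrence. -/
lemma wallis_coeff_succ (n : ℕ) :
    ((2 * (n + 1)).factorial : ℝ) / (2 ^ (2 * (n + 1)) * ((n + 1).factorial : ℝ) ^ 2) =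
      (2 * (n : ℝ) + 1) / (2 * n + 2) *
        (((2 * n).factorial : ℝ) / (2 ^ (2 * n) * (n.factorial : ℝ) ^ 2)) := by
  have h : 2 * (n + 1) = 2 * n + 1 + 1 := by ring
  have hn : (n.factorial : ℝ) ≠ 0 := by positivity
  rw [h, Nat.factorial_succ, Nat.factorial_succ, Nat.factorial_succ]
  push_cast
  field_simp
  ring

/-- The coefficients of the binomial series of exponent `-1 / 2`. -/
lemma choose_one_half_add_sub_one (n : ℕ) :
    Ring.choose ((1 / 2 : ℝ) + n - 1) n =
      ((2 * n).factorial : ℝ) / (2 ^ (2 * n) * (n.factorial : ℝ) ^ 2) := by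
  rw [← Ring.multichoose_eq]
  have key : (ascPochhammer ℝ n).eval (1 / 2) =
      n.factorial * (((2 * n).factorial : ℝ) / (2 ^ (2 * n) * (n.factorial : ℝ) ^ 2)) := by
    induction n with
    | zero => simp
    | succ m ih =>
      rw [ascPochhammer_succ_eval, ih, wallis_coeff_succ, Nat.factorial_succ m]
      push_cast
      field_simp
      ring
  have h := Ring.factorial_nsmul_multichoose_eq_ascPochhammer (1 / 2 : ℝ) n
  rw [Polynomial.ascPochhammer_smeval_eq_eval, key, nsmul_eq_mul] at h
  exact mul_left_cancel₀ (by positivity) h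

/-- The binomial series of `1 / √(1 - x)`. -/
lemma hasSum_one_div_sqrt_one_sub {x : ℝ} (hx : |x| < 1) :
    HasSum (fun n : ℕ =>
      ((2 * n).factorial : ℝ) / (2 ^ (2 * n) * (n.factorial : ℝ) ^ 2) * x ^ n)
      (1 / √(1 - x)) := by
  have h := (one_div_one_sub_rpow_hasFPowerSeriesOnBall_zero (1 / 2)).hasSum
    (y := x) (by simpa [enorm_eq_nnnorm, ← NNReal.coe_lt_coe] using hx)
  simp_rw [← choose_one_half_add_sub_one, mul_comm _ (x ^ _)]
  simpa [FormalMultilinearSeries.ofScalars_apply_eq, Real.sqrt_eq_rpow] using h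

lemma integral_sin_pow_even_half (n : ℕ) :
    ∫ θ in (0 : ℝ)..(π / 2), sin θ ^ (2 * n) =
      π / 2 * (((2 * n).factorial : ℝ) / (2 ^ (2 * n) * (n.factorial : ℝ) ^ 2)) := by
  induction n with
  | zero => simp
  | succ m ih =>
    rw [wallis_coeff_succ, show 2 * (m + 1) = 2 * m + 2 by ring, integral_sin_pow, ih]
    simp
    ring

/-- The substitution `t = sin θ` turns `K(k)` into Legendre's trigonometric form. -/
lemma ellK_eq_integral_sin (k : ℝ) :
    ellK k = ∫ θ in (0 : ℝ)..(π / 2), 1 / √(1 - (k * sin θ) ^ 2) := by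
  have hpi := Real.pi_pos
  have himage : sin '' Ioo 0 (π / 2) = Ioo 0 1 := by
    ext t
    constructor
    · rintro ⟨θ, ⟨h0, h1⟩, rfl⟩
      refine ⟨sin_pos_of_pos_of_lt_pi h0 (by linarith), ?_⟩
      rw [← sin_pi_div_two]
      exact sin_lt_sin_of_lt_of_le_pi_div_two (by linarith) le_rfl h1
    · rintro ⟨h0, h1⟩
      exact ⟨arcsin t, ⟨arcsin_pos.2 h0, arcsin_lt_pi_div_two.2 h1⟩,
        sin_arcsin (by linarith) h1.le⟩
  have hinj : InjOn sin (Ioo 0 (π / 2)) :=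
    injOn_sin.mono (Ioo_subset_Icc_self.trans (Icc_subset_Icc_left (by linarith)))
  rw [ellK, ellF, intervalIntegral.integral_of_le zero_le_one,
    intervalIntegral.integral_of_le (by positivity), integral_Ioc_eq_integral_Ioo,
    integral_Ioc_eq_integral_Ioo, ← himage,
    integral_image_eq_integral_abs_deriv_smul measurableSet_Ioo
      (fun θ _ => (hasDerivAt_sin θ).hasDerivWithinAt) hinj]
  refine setIntegral_congr_fun measurableSet_Ioo fun θ hθ => ?_
  have hcos : 0 < cos θ := cos_pos_of_mem_Ioo ⟨by linarith [hθ.1], hθ.2⟩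
  have hsq : 1 - sin θ ^ 2 = cos θ ^ 2 := by rw [cos_sq']
  simp only [smul_eq_mul]
  rw [hsq, Real.sqrt_mul (sq_nonneg _), Real.sqrt_sq hcos.le, abs_of_pos hcos, mul_pow]
  field_simp

/-- series expansion of the complete elliptic integral of the first kind. -/
theorem stmt_6 (k : ℝ) (hk0 : 0 < k) (hk1 : k < 1) :
    HasSum
      (fun n : ℕ =>
        (Real.pi / 2) *
          ((Nat.factorial (2 * n) : ℝ) / (2 ^ (2 * n) * (Nat.factorial n : ℝ) ^ 2)) ^ 2
          * k ^ (2 * n))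
      (ellK k) := by
  have hsq : |k ^ 2| < 1 := by
    rw [abs_of_nonneg (sq_nonneg k)]
    nlinarith
  rw [ellK_eq_integral_sin]
  have h := intervalIntegral.hasSum_integral_of_dominated_convergence
    (μ := volume) (a := 0) (b := π / 2)
    (F := fun (n : ℕ) θ => ((2 * n).factorial : ℝ) / (2 ^ (2 * n) * (n.factorial : ℝ) ^ 2) *
      ((k * sin θ) ^ 2) ^ n)
    (f := fun θ => 1 / √(1 - (k * sin θ) ^ 2))
    (fun n _ => ((2 * n).factorial : ℝ) / (2 ^ (2 * n) * (n.factorial : ℝ) ^ 2) * (k ^ 2) ^ n)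
    (fun n => by
      apply Continuous.aestronglyMeasurable
      fun_prop)
    (fun n => ae_of_all _ fun θ _ => by
      rw [Real.norm_of_nonneg (by positivity), mul_pow]
      gcongr
      exact mul_le_of_le_one_right (sq_nonneg k) (sin_sq_le_one θ))
    (ae_of_all _ fun θ _ => (hasSum_one_div_sqrt_one_sub hsq).summable)
    intervalIntegrable_const
    (ae_of_all _ fun θ _ => hasSum_one_div_sqrt_one_sub (by
      rw [abs_of_nonneg (sq_nonneg _), mul_pow]
      rw [abs_of_nonneg (sq_nonneg k)] at hsq
      exact (mul_le_of_le_one_right (sq_nonneg k) (sin_sq_le_one θ)).trans_lt hsq))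
  refine h.congr_fun fun n => ?_
  simp_rw [mul_pow, ← pow_mul]
  rw [intervalIntegral.integral_const_mul, intervalIntegral.integral_const_mul,
    integral_sin_pow_even_half]
  ring
end

section
/- The incomplete elliptic integral of the first kind satisfies F(x, k) = I_0(x) + (1/2)·I_2(x)·k² + o(k²) as k → 0⁺, uniformly with respect to x ∈ (0, 1); that is, sup_{0 < x < 1} |F(x, k) − I_0(x) − (1/2) I_2(x) k²| / k² → 0 as k → 0⁺. -/
open MeasureTheory Real Filter Set Topology

/-- Second-order Taylor bound for `1 / √(1 - u)` at `u = 0`. -/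
theorem abs_one_div_sqrt_one_sub_sub_le {u : ℝ} (h0 : 0 ≤ u) (h1 : u ≤ 1 / 2) :
    |1 / Real.sqrt (1 - u) - 1 - u / 2| ≤ 3 * u ^ 2 := by
  have hs2 : Real.sqrt (1 - u) ^ 2 = 1 - u := Real.sq_sqrt (by linarith)
  have hs_half : 1 / 2 ≤ Real.sqrt (1 - u) := Real.le_sqrt_of_sq_le (by linarith)
  generalize Real.sqrt (1 - u) = s at hs2 hs_half ⊢
  have hs_one : s ≤ 1 := by nlinarith
  have hs_pos : 0 < s := by linarith
  obtain rfl : u = 1 - s ^ 2 := by linarith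
  have key : 1 / s - 1 - (1 - s ^ 2) / 2 = (1 - s) ^ 2 * (s + 2) / (2 * s) := by
    field_simp
    ring
  rw [key, abs_of_nonneg (by positivity), div_le_iff₀ (by positivity)]
  have h : s + 2 ≤ 3 * (1 + s) ^ 2 * (2 * s) := by nlinarith
  calc (1 - s) ^ 2 * (s + 2) ≤ (1 - s) ^ 2 * (3 * (1 + s) ^ 2 * (2 * s)) := by gcongr
    _ = 3 * (1 - s ^ 2) ^ 2 * (2 * s) := by ring

theorem one_sub_sq_pos_of_mem_uIcc {x t : ℝ} (hx0 : 0 < x) (hx1 : x < 1) (ht : t ∈ uIcc 0 x) :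
    0 < 1 - t ^ 2 := by
  rw [uIcc_of_le hx0.le] at ht
  nlinarith [ht.1, ht.2]

theorem intervalIntegrable_pow_div_sqrt_one_sub_sq (n : ℕ) {x : ℝ} (hx0 : 0 < x) (hx1 : x < 1) :
    IntervalIntegrable (fun t : ℝ => t ^ n / Real.sqrt (1 - t ^ 2)) volume 0 x :=
  ContinuousOn.intervalIntegrable <| ContinuousOn.div (by fun_prop) (by fun_prop) fun _ ht =>
    (Real.sqrt_pos.2 (one_sub_sq_pos_of_mem_uIcc hx0 hx1 ht)).ne'

theorem I2n_zero_eq_arcsin {x : ℝ} (hx0 : 0 < x) (hx1 : x < 1) : I2n 0 x = arcsin x := by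
  have h := intervalIntegral.integral_eq_sub_of_hasDerivAt (f := arcsin) (a := 0) (b := x)
    (f' := fun t : ℝ => t ^ (2 * 0) / Real.sqrt (1 - t ^ 2))
    (fun t ht => by
      have ht' := one_sub_sq_pos_of_mem_uIcc hx0 hx1 ht
      simpa using Real.hasDerivAt_arcsin (x := t) (by rintro rfl; norm_num at ht')
        (by rintro rfl; norm_num at ht'))
    (intervalIntegrable_pow_div_sqrt_one_sub_sq _ hx0 hx1)
  rw [I2n, h, arcsin_zero, sub_zero]

theorem abs_ellF_sub_le {x k : ℝ} (hx0 : 0 < x) (hx1 : x < 1) (hk0 : 0 < k) (hk1 : k < 1 / 2) :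
    |ellF x k - I2n 0 x - (1 / 2) * I2n 1 x * k ^ 2| ≤ 3 * k ^ 4 * (π / 2) := by
  have hu : ∀ t : ℝ, 0 < 1 - t ^ 2 → k ^ 2 * t ^ 2 ≤ 1 / 2 := fun t ht => by
    nlinarith [sq_nonneg t]
  have hF : IntervalIntegrable
      (fun t : ℝ => 1 / Real.sqrt ((1 - t ^ 2) * (1 - k ^ 2 * t ^ 2))) volume 0 x :=
    ContinuousOn.intervalIntegrable <| ContinuousOn.div (by fun_prop) (by fun_prop) fun t ht => by
      have h := one_sub_sq_pos_of_mem_uIcc hx0 hx1 ht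
      exact (Real.sqrt_pos.2 (mul_pos h (by linarith [hu t h]))).ne'
  have h0 := intervalIntegrable_pow_div_sqrt_one_sub_sq (2 * 0) hx0 hx1
  have h2 := intervalIntegrable_pow_div_sqrt_one_sub_sq (2 * 1) hx0 hx1
  have hsplit : ellF x k - I2n 0 x - (1 / 2) * I2n 1 x * k ^ 2 =
      ∫ t in (0:ℝ)..x, (1 / Real.sqrt ((1 - t ^ 2) * (1 - k ^ 2 * t ^ 2))
        - t ^ (2 * 0) / Real.sqrt (1 - t ^ 2)
        - (1 / 2) * (t ^ (2 * 1) / Real.sqrt (1 - t ^ 2)) * k ^ 2) := by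
    rw [intervalIntegral.integral_sub (hF.sub h0) ((h2.const_mul _).mul_const _),
      intervalIntegral.integral_sub hF h0, intervalIntegral.integral_mul_const,
      intervalIntegral.integral_const_mul]
    rfl
  have hbound : |ellF x k - I2n 0 x - (1 / 2) * I2n 1 x * k ^ 2| ≤
      ∫ t in (0:ℝ)..x, 3 * k ^ 4 * (t ^ (2 * 0) / Real.sqrt (1 - t ^ 2)) := by
    rw [hsplit, ← Real.norm_eq_abs]
    refine intervalIntegral.norm_integral_le_of_norm_le hx0.le (ae_of_all _ fun t ht => ?_)
      (h0.const_mul _)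
    have ht' : 0 < 1 - t ^ 2 :=
      one_sub_sq_pos_of_mem_uIcc hx0 hx1 (uIoc_subset_uIcc (uIoc_of_le hx0.le ▸ ht))
    have hfactor : 1 / Real.sqrt ((1 - t ^ 2) * (1 - k ^ 2 * t ^ 2))
        - t ^ (2 * 0) / Real.sqrt (1 - t ^ 2)
        - (1 / 2) * (t ^ (2 * 1) / Real.sqrt (1 - t ^ 2)) * k ^ 2
        = (1 / Real.sqrt (1 - k ^ 2 * t ^ 2) - 1 - k ^ 2 * t ^ 2 / 2)
          * (1 / Real.sqrt (1 - t ^ 2)) := by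
      rw [Real.sqrt_mul ht'.le, ← one_div_mul_one_div]
      ring
    have hsq : (k ^ 2 * t ^ 2) ^ 2 ≤ k ^ 4 := by
      have : k ^ 2 * t ^ 2 ≤ k ^ 2 * 1 := by gcongr; linarith
      calc (k ^ 2 * t ^ 2) ^ 2 ≤ (k ^ 2 * 1) ^ 2 := by gcongr
        _ = k ^ 4 := by ring
    rw [hfactor, Real.norm_eq_abs, abs_mul, abs_of_nonneg (by positivity :
      0 ≤ 1 / Real.sqrt (1 - t ^ 2)), mul_zero, pow_zero]
    gcongr
    exact (abs_one_div_sqrt_one_sub_sub_le (by positivity) (hu t ht')).trans (by linarith)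
  calc _ ≤ _ := hbound
    _ = 3 * k ^ 4 * I2n 0 x := intervalIntegral.integral_const_mul _ _
    _ ≤ 3 * k ^ 4 * (π / 2) := by
      rw [I2n_zero_eq_arcsin hx0 hx1]
      gcongr
      exact arcsin_le_pi_div_two x

/-- `F(x,k) = I₀(x) + (1/2) I₂(x) k² + o(k²)` uniformly in `x ∈ (0,1)`. -/
theorem stmt_14 :
    Tendsto
      (fun k : ℝ =>
        ⨆ x : Set.Ioo (0:ℝ) 1,
          |ellF x k - I2n 0 x - (1 / 2) * I2n 1 x * k ^ 2| / k ^ 2)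
      (nhdsWithin 0 (Set.Ioi 0)) (nhds 0) := by
  have hlim : Tendsto (fun k : ℝ => 3 * k ^ 2 * (π / 2)) (𝓝[>] 0) (𝓝 0) := by
    refine tendsto_nhdsWithin_of_tendsto_nhds ?_
    have h : Continuous fun k : ℝ => 3 * k ^ 2 * (π / 2) := by fun_prop
    simpa using h.tendsto 0
  refine squeeze_zero' (Eventually.of_forall fun k => Real.iSup_nonneg fun x => by positivity)
    ?_ hlim
  filter_upwards [Ioo_mem_nhdsGT (show (0:ℝ) < 1 / 2 by norm_num)] with k hk
  have hk0 : 0 < k := hk.1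
  refine Real.iSup_le (fun x => ?_) (by positivity)
  rw [div_le_iff₀ (by positivity)]
  exact (abs_ellF_sub_le x.2.1 x.2.2 hk0 hk.2).trans_eq (by ring)
end

section
/- One has K(k)·E(x, k) − E(k)·F(x, k) = (π/4)·[I_0(x) − 2·I_2(x)]·k² + o(k²) as k → 0⁺, uniformly with respect to x ∈ (0, 1); that is, sup_{0 < x < 1} |K(k)E(x,k) − E(k)F(x,k) − (π/4)(I_0(x) − 2I_2(x))k²| / k² → 0 as k → 0⁺. -/
open MeasureTheory Real Filter Set Topology

lemma intervalIntegrable_inv_sqrt_one_sub_sq {x : ℝ} (hx : x ∈ Icc (0:ℝ) 1) :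
    IntervalIntegrable (fun t : ℝ => (√(1 - t ^ 2))⁻¹) volume 0 x := by
  refine (intervalIntegrable_iff_integrableOn_Ioc_of_le hx.1).2 ?_
  refine intervalIntegral.integrableOn_deriv_of_nonneg (g := arcsin)
    continuous_arcsin.continuousOn (fun t ht => ?_) (fun t _ => by positivity)
  have h := hasDerivAt_arcsin (x := t) (by linarith [ht.1]) (by linarith [ht.2, hx.2])
  simpa using h

lemma integral_inv_sqrt_one_sub_sq {x : ℝ} (hx : x ∈ Icc (0:ℝ) 1) :
    ∫ t in (0:ℝ)..x, (√(1 - t ^ 2))⁻¹ = arcsin x := by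
  have := intervalIntegral.integral_eq_sub_of_hasDerivAt_of_le hx.1 (f := arcsin)
    continuous_arcsin.continuousOn (fun t ht => by
      simpa using hasDerivAt_arcsin (x := t) (by linarith [ht.1]) (by linarith [ht.2, hx.2]))
    (intervalIntegrable_inv_sqrt_one_sub_sq hx)
  simpa using this

lemma I2n_zero_eq {x : ℝ} (hx : x ∈ Icc (0:ℝ) 1) : I2n 0 x = arcsin x := by
  simpa [I2n] using integral_inv_sqrt_one_sub_sq hx

lemma I2n_one_eq {x : ℝ} (hx : x ∈ Icc (0:ℝ) 1) :
    I2n 1 x = (arcsin x - x * √(1 - x ^ 2)) / 2 := by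
  have hint : IntervalIntegrable (fun t : ℝ => t ^ (2 * 1) / √(1 - t ^ 2)) volume 0 x := by
    simpa [div_eq_mul_inv] using (intervalIntegrable_inv_sqrt_one_sub_sq hx).continuousOn_mul
      (g := fun t : ℝ => t ^ 2) (by fun_prop)
  have := intervalIntegral.integral_eq_sub_of_hasDerivAt_of_le hx.1
    (f := fun t => (arcsin t - t * √(1 - t ^ 2)) / 2)
    (((continuous_arcsin.sub (by fun_prop)).div_const 2).continuousOn) (fun t ht => by
      have hpos : 0 < 1 - t ^ 2 := by nlinarith [ht.1, ht.2, hx.2]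
      have h1 := hasDerivAt_arcsin (x := t) (by linarith [ht.1]) (by linarith [ht.2, hx.2])
      have h2 : HasDerivAt (fun t : ℝ => 1 - t ^ 2) (-(2 * t)) t := by
        simpa using (hasDerivAt_pow 2 t).const_sub 1
      have h3 := (h1.sub ((hasDerivAt_id t).mul (h2.sqrt hpos.ne'))).div_const 2
      refine h3.congr_deriv ?_
      have hs : √(1 - t ^ 2) ≠ 0 := (Real.sqrt_pos.2 hpos).ne'
      have hsq : √(1 - t ^ 2) ^ 2 = 1 - t ^ 2 := Real.sq_sqrt hpos.le
      dsimp only [id]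
      field_simp
      rw [hsq]
      ring)
    hint
  simpa [I2n] using this

lemma arcsin_mem_Icc_zero_two {x : ℝ} (hx : x ∈ Icc (0:ℝ) 1) : arcsin x ∈ Icc (0:ℝ) 2 :=
  ⟨arcsin_nonneg.2 hx.1, by linarith [arcsin_le_pi_div_two x, pi_le_four]⟩

lemma I2n_one_mem_Icc_zero_one {x : ℝ} (hx : x ∈ Icc (0:ℝ) 1) : I2n 1 x ∈ Icc (0:ℝ) 1 := by
  constructor
  · exact intervalIntegral.integral_nonneg hx.1 fun t ht => by have := ht.1; positivity
  · rw [I2n_one_eq hx]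
    have := mul_nonneg hx.1 (Real.sqrt_nonneg (1 - x ^ 2))
    linarith [(arcsin_mem_Icc_zero_two hx).2]

lemma abs_integral_mul_inv_sqrt_sub_le {φ : ℝ → ℝ} {c d x : ℝ}
    (hφ : ContinuousOn φ (Icc 0 1)) (h : ∀ t ∈ Icc (0:ℝ) 1, |φ t - (1 + c * t ^ 2)| ≤ d)
    (hx : x ∈ Icc (0:ℝ) 1) :
    |(∫ t in (0:ℝ)..x, φ t * (√(1 - t ^ 2))⁻¹) - (arcsin x + c * I2n 1 x)| ≤ d * 2 := by
  have hw := intervalIntegrable_inv_sqrt_one_sub_sq hx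
  have hd : 0 ≤ d := (abs_nonneg _).trans (h 0 (by simp))
  have hφx : ContinuousOn φ (uIcc 0 x) := by
    rw [uIcc_of_le hx.1]; exact hφ.mono (Icc_subset_Icc_right hx.2)
  have h1 := hw.continuousOn_mul hφx
  have h2 := hw.continuousOn_mul (g := fun t : ℝ => t ^ 2) (by fun_prop)
  have hI : I2n 1 x = ∫ t in (0:ℝ)..x, t ^ 2 * (√(1 - t ^ 2))⁻¹ := by
    simp [I2n, div_eq_mul_inv]
  rw [hI, ← integral_inv_sqrt_one_sub_sq hx, ← intervalIntegral.integral_const_mul,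
    ← intervalIntegral.integral_add hw (h2.const_mul c),
    ← intervalIntegral.integral_sub h1 (hw.add (h2.const_mul c)), ← Real.norm_eq_abs]
  calc _ ≤ ∫ t in (0:ℝ)..x, d * (√(1 - t ^ 2))⁻¹ := by
        refine intervalIntegral.norm_integral_le_of_norm_le hx.1
          (Eventually.of_forall fun t ht => ?_) (hw.const_mul d)
        have hs : 0 ≤ (√(1 - t ^ 2))⁻¹ := by positivity
        rw [Real.norm_eq_abs, show φ t * (√(1 - t ^ 2))⁻¹
            - ((√(1 - t ^ 2))⁻¹ + c * (t ^ 2 * (√(1 - t ^ 2))⁻¹))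
          = (φ t - (1 + c * t ^ 2)) * (√(1 - t ^ 2))⁻¹ by ring, abs_mul, abs_of_nonneg hs]
        exact mul_le_mul_of_nonneg_right (h t ⟨ht.1.le, ht.2.trans hx.2⟩) hs
    _ = d * arcsin x := by
        rw [intervalIntegral.integral_const_mul, integral_inv_sqrt_one_sub_sq hx]
    _ ≤ d * 2 := by gcongr; exact (arcsin_mem_Icc_zero_two hx).2

lemma abs_sqrt_one_sub_sub_le {u : ℝ} (h0 : 0 ≤ u) (h1 : u ≤ 1 / 4) :
    |√(1 - u) - (1 - u / 2)| ≤ u ^ 2 := by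
  have hs : √(1 - u) ≤ 1 - u / 2 := Real.sqrt_le_iff.2 ⟨by linarith, by nlinarith⟩
  have hs' : 1 - u / 2 - u ^ 2 ≤ √(1 - u) := Real.le_sqrt_of_sq_le 
    (by nlinarith [pow_nonneg h0 2, pow_nonneg h0 3])
  rw [abs_le]
  constructor <;> nlinarith

lemma abs_inv_sqrt_one_sub_sub_le {u : ℝ} (h0 : 0 ≤ u) (h1 : u ≤ 1 / 4) :
    |(√(1 - u))⁻¹ - (1 + u / 2)| ≤ u ^ 2 := by
  have hpos : 0 < √(1 - u) := Real.sqrt_pos.2 (by linarith)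
  have hs : √(1 - u) ≤ (1 + u / 2)⁻¹ := by
    refine Real.sqrt_le_iff.2 ⟨by positivity, ?_⟩
    rw [inv_pow, ← one_div, le_div_iff₀ (by positivity)]
    nlinarith [pow_nonneg h0 2, pow_nonneg h0 3]
  have hs' : (1 + u / 2 + u ^ 2)⁻¹ ≤ √(1 - u) := by
    refine Real.le_sqrt_of_sq_le ?_
    rw [inv_pow, ← one_div, div_le_iff₀ (by positivity)]
    have : (1 - u) * (1 + u / 2 + u ^ 2) ^ 2 - 1
      = u ^ 2 * (5 / 4 - 5 / 4 * u - u ^ 3) := by ring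
    have h3 : u ^ 3 ≤ 1 / 4 := by
      calc u ^ 3 ≤ (1 / 4) ^ 3 := by gcongr
        _ ≤ 1 / 4 := by norm_num
    nlinarith [mul_nonneg (pow_nonneg h0 2) (show 0 ≤ 5 / 4 - 5 / 4 * u - u ^ 3 by linarith)]
  have e1 : 1 + u / 2 ≤ (√(1 - u))⁻¹ := (le_inv_comm₀ hpos (by positivity)).1 hs
  have e2 : (√(1 - u))⁻¹ ≤ 1 + u / 2 + u ^ 2 := (inv_le_comm₀ (by positivity) hpos).1 hs'
  rw [abs_le]
  constructor <;> nlinarith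

lemma sq_mul_sq_bounds {k t : ℝ} (hk : k ^ 2 ≤ 1 / 4) (ht : t ∈ Icc (0:ℝ) 1) :
    0 ≤ k ^ 2 * t ^ 2 ∧ k ^ 2 * t ^ 2 ≤ 1 / 4 ∧ (k ^ 2 * t ^ 2) ^ 2 ≤ k ^ 4 := by
  have h : k ^ 2 * t ^ 2 ≤ k ^ 2 :=
    mul_le_of_le_one_right (sq_nonneg k) (pow_le_one₀ ht.1 ht.2)
  refine ⟨by positivity, h.trans hk, ?_⟩
  calc (k ^ 2 * t ^ 2) ^ 2 ≤ (k ^ 2) ^ 2 := by gcongr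
    _ = k ^ 4 := by ring

lemma abs_ellE_sub_le {k x : ℝ} (hk : k ^ 2 ≤ 1 / 4) (hx : x ∈ Icc (0:ℝ) 1) :
    |ellE x k - (arcsin x + -(k ^ 2 / 2) * I2n 1 x)| ≤ k ^ 4 * 2 := by
  have h : ellE x k = ∫ t in (0:ℝ)..x, √(1 - k ^ 2 * t ^ 2) * (√(1 - t ^ 2))⁻¹ := by
    refine intervalIntegral.integral_congr fun t ht => ?_
    rw [uIcc_of_le hx.1] at ht
    have := sq_mul_sq_bounds hk ⟨ht.1, ht.2.trans hx.2⟩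
    rw [Real.sqrt_div (by linarith), div_eq_mul_inv]
  rw [h]
  refine abs_integral_mul_inv_sqrt_sub_le (by fun_prop) (fun t ht => ?_) hx
  obtain ⟨h0, h1, h2⟩ := sq_mul_sq_bounds hk ht
  refine le_trans (le_of_eq ?_) ((abs_sqrt_one_sub_sub_le h0 h1).trans h2)
  ring_nf

lemma abs_ellF_sub_le_s15 {k x : ℝ} (hk : k ^ 2 ≤ 1 / 4) (hx : x ∈ Icc (0:ℝ) 1) :
    |ellF x k - (arcsin x + k ^ 2 / 2 * I2n 1 x)| ≤ k ^ 4 * 2 := by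
  have h : ellF x k = ∫ t in (0:ℝ)..x, (√(1 - k ^ 2 * t ^ 2))⁻¹ * (√(1 - t ^ 2))⁻¹ := by
    refine intervalIntegral.integral_congr fun t ht => ?_
    rw [uIcc_of_le hx.1] at ht
    have := sq_mul_sq_bounds hk ⟨ht.1, ht.2.trans hx.2⟩
    rw [Real.sqrt_mul' _ (by linarith), one_div, mul_inv, mul_comm]
  rw [h]
  refine abs_integral_mul_inv_sqrt_sub_le ?_ (fun t ht => ?_) hx
  · refine ContinuousOn.inv₀ (by fun_prop) fun t ht => ?_
    have := sq_mul_sq_bounds hk ht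
    exact (Real.sqrt_pos.2 (by linarith)).ne'
  obtain ⟨h0, h1, h2⟩ := sq_mul_sq_bounds hk ht
  refine le_trans (le_of_eq ?_) ((abs_inv_sqrt_one_sub_sub_le h0 h1).trans h2)
  ring_nf

lemma abs_elliptic_sub_le {k x : ℝ} (hk : k ^ 2 ≤ 1 / 4) (hx : x ∈ Icc (0:ℝ) 1) :
    |ellK k * ellE x k - ellEc k * ellF x k
      - (Real.pi / 4) * (I2n 0 x - 2 * I2n 1 x) * k ^ 2| ≤ 24 * k ^ 4 := by
  have one_mem : (1:ℝ) ∈ Icc (0:ℝ) 1 := by simp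
  have hE := abs_ellE_sub_le hk hx
  have hF := abs_ellF_sub_le_s15 hk hx
  have hK := abs_ellF_sub_le_s15 hk one_mem
  have hEc := abs_ellE_sub_le hk one_mem
  have hI : I2n 1 1 = π / 4 := by rw [I2n_one_eq one_mem]; simp; ring
  rw [hI, arcsin_one] at hK hEc
  have hA := arcsin_mem_Icc_zero_two hx
  have hB := I2n_one_mem_Icc_zero_one hx
  rw [I2n_zero_eq hx, ellK, ellEc]
  set A := arcsin x
  set B := I2n 1 x
  set e := ellE x k - (A + -(k ^ 2 / 2) * B) with he
  set f := ellF x k - (A + k ^ 2 / 2 * B) with hf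
  set κ := ellF 1 k - (π / 2 + k ^ 2 / 2 * (π / 4)) with hκ
  set ε := ellE 1 k - (π / 2 + -(k ^ 2 / 2) * (π / 4)) with hε
  have key : ellF 1 k * ellE x k - ellE 1 k * ellF x k - π / 4 * (A - 2 * B) * k ^ 2
      = (π / 2 + k ^ 2 / 2 * (π / 4)) * e + κ * (e + (A + -(k ^ 2 / 2) * B))
        - ((π / 2 + -(k ^ 2 / 2) * (π / 4)) * f + ε * (f + (A + k ^ 2 / 2 * B))) := by
    rw [he, hf, hκ, hε]; ring
  have hk0 := sq_nonneg k
  have hk4 : k ^ 4 ≤ 1 / 16 := by nlinarith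
  have hπ := pi_pos
  have hπ4 := pi_le_four
  have bound : ∀ {a b : ℝ}, |a| ≤ 3 → |b| ≤ k ^ 4 * 2 → |a * b| ≤ 6 * k ^ 4 := by
    intro a b ha hb
    rw [abs_mul]
    calc |a| * |b| ≤ 3 * (k ^ 4 * 2) := by gcongr
      _ = 6 * k ^ 4 := by ring
  have hkB : 0 ≤ k ^ 2 / 2 * B := mul_nonneg (by positivity) hB.1
  have hkB' : k ^ 2 / 2 * B ≤ 1 / 8 := by nlinarith [hB.1, hB.2]
  have hkπ : 0 ≤ k ^ 2 / 2 * (π / 4) := by positivity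
  have hkπ' : k ^ 2 / 2 * (π / 4) ≤ 1 / 8 := by nlinarith
  have hE' := abs_le.1 hE
  have hF' := abs_le.1 hF
  have b1 := bound (a := π / 2 + k ^ 2 / 2 * (π / 4)) (abs_le.2 ⟨by linarith, by linarith⟩) hE
  have b2 := bound (a := e + (A + -(k ^ 2 / 2) * B))
    (abs_le.2 ⟨by linarith [hA.1, hA.2], by linarith [hA.1, hA.2]⟩) hK
  have b3 := bound (a := π / 2 + -(k ^ 2 / 2) * (π / 4))
    (abs_le.2 ⟨by linarith, by linarith⟩) hF
  have b4 := bound (a := f + (A + k ^ 2 / 2 * B))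
    (abs_le.2 ⟨by linarith [hA.1, hA.2], by linarith [hA.1, hA.2]⟩) hEc
  rw [key, mul_comm κ, mul_comm ε]
  rw [abs_le] at b1 b2 b3 b4 ⊢
  constructor <;> linarith [b1.1, b1.2, b2.1, b2.2, b3.1, b3.2, b4.1, b4.2]

/-- `K(k)E(x,k) − E(k)F(x,k) = (π/4)(I₀(x) − 2I₂(x))k² + o(k²)`
uniformly in `x ∈ (0,1)`. -/
theorem stmt_15 :
    Tendsto
      (fun k : ℝ =>
        ⨆ x : Set.Ioo (0:ℝ) 1,
          |ellK k * ellE x k - ellEc k * ellF x k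
            - (Real.pi / 4) * (I2n 0 x - 2 * I2n 1 x) * k ^ 2| / k ^ 2)
      (nhdsWithin 0 (Set.Ioi 0)) (nhds 0) := by
  have hlim : Tendsto (fun k : ℝ => 24 * k ^ 2) (𝓝[>] 0) (𝓝 0) := by
    have : Tendsto (fun k : ℝ => 24 * k ^ 2) (𝓝 0) (𝓝 (24 * 0 ^ 2)) :=
      Continuous.tendsto (by fun_prop) 0
    simpa using this.mono_left nhdsWithin_le_nhds
  refine squeeze_zero' (Eventually.of_forall fun k => Real.iSup_nonneg fun x => by positivity)
    ?_ hlim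
  filter_upwards [Ioo_mem_nhdsGT (show (0:ℝ) < 1 / 2 by norm_num)] with k hk
  refine Real.iSup_le (fun x => ?_) (by positivity)
  have hk0 : 0 < k := hk.1
  rw [div_le_iff₀ (by positivity)]
  refine (abs_elliptic_sub_le (by nlinarith [hk.2]) ⟨x.2.1.le, x.2.2.le⟩).trans (le_of_eq ?_)
  ring
end

section
/- As k → 1⁻, the quantity E(k) − (1 − E'(k)/K'(k))·K(k) tends to 1, where K'(k) = K(√(1 − k²)) and E'(k) = E(√(1 − k²)). -/
open MeasureTheory Real Filter Set Topology

/-- The derivative of `arcsin` is integrable on `[0, 1]`. -/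
theorem intervalIntegrable_one_div_sqrt_one_sub_sq :
    IntervalIntegrable (fun t : ℝ => 1 / √(1 - t ^ 2)) volume 0 1 := by
  refine intervalIntegral.intervalIntegrable_deriv_of_nonneg (g := Real.arcsin)
    Real.continuous_arcsin.continuousOn (fun t ht => ?_) (fun t _ => by positivity)
  rw [min_eq_left zero_le_one, max_eq_right zero_le_one] at ht
  exact Real.hasDerivAt_arcsin (by linarith [ht.1]) (by linarith [ht.2])

theorem one_sub_mul_sq_pos {k t : ℝ} (hk : k ^ 2 < 1) (ht0 : 0 ≤ t) (ht1 : t ≤ 1) :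
    0 < 1 - k ^ 2 * t ^ 2 := by
  nlinarith [sq_nonneg k, pow_le_one₀ (n := 2) ht0 ht1]

theorem ellE_integrand_eq {k t : ℝ} (hk : k ^ 2 < 1) (ht0 : 0 ≤ t) (ht1 : t ≤ 1) :
    √((1 - k ^ 2 * t ^ 2) / (1 - t ^ 2)) =
      (1 - k ^ 2 * t ^ 2) * (1 / √((1 - t ^ 2) * (1 - k ^ 2 * t ^ 2))) := by
  have hB := one_sub_mul_sq_pos hk ht0 ht1
  have hA : 0 ≤ 1 - t ^ 2 := by nlinarith
  rw [Real.sqrt_div hB.le, Real.sqrt_mul hA]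
  nth_rewrite 2 [← Real.mul_self_sqrt hB.le]
  have hB' := Real.sqrt_pos.2 hB
  field_simp

theorem ellE_integrand_le {k t : ℝ} (hk : k ^ 2 < 1) (ht0 : 0 ≤ t) (ht1 : t ≤ 1) :
    √((1 - k ^ 2 * t ^ 2) / (1 - t ^ 2)) ≤ 1 / √(1 - t ^ 2) := by
  rw [Real.sqrt_div (one_sub_mul_sq_pos hk ht0 ht1).le]
  gcongr
  exact Real.sqrt_le_one.2 (by nlinarith [mul_nonneg (sq_nonneg k) (sq_nonneg t)])

theorem ellF_integrand_le {k t : ℝ} (hk : k ^ 2 < 1) (ht0 : 0 ≤ t) (ht1 : t ≤ 1) :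
    1 / √((1 - t ^ 2) * (1 - k ^ 2 * t ^ 2)) ≤
      1 / √(1 - k ^ 2) * (1 / √(1 - t ^ 2)) := by
  have hA : 0 ≤ 1 - t ^ 2 := by nlinarith
  have h1 : √(1 - k ^ 2) ≤ √(1 - k ^ 2 * t ^ 2) := by
    apply Real.sqrt_le_sqrt
    nlinarith [mul_nonneg (sq_nonneg k) hA]
  have h2 : 0 < √(1 - k ^ 2) := Real.sqrt_pos.2 (by linarith)
  rw [Real.sqrt_mul hA, mul_comm, ← one_div_mul_one_div]
  gcongr

theorem intervalIntegrable_ellF_integrand {k : ℝ} (hk : k ^ 2 < 1) :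
    IntervalIntegrable (fun t : ℝ => 1 / √((1 - t ^ 2) * (1 - k ^ 2 * t ^ 2))) volume 0 1 := by
  refine (intervalIntegrable_one_div_sqrt_one_sub_sq.const_mul (1 / √(1 - k ^ 2))).mono_fun'
    (Measurable.aestronglyMeasurable (by fun_prop)) ?_
  filter_upwards [ae_restrict_mem measurableSet_uIoc] with t ht
  rw [uIoc_of_le zero_le_one] at ht
  rw [Real.norm_of_nonneg (by positivity)]
  exact ellF_integrand_le hk ht.1.le ht.2

theorem intervalIntegrable_ellE_integrand {k : ℝ} (hk : k ^ 2 < 1) :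
    IntervalIntegrable (fun t : ℝ => √((1 - k ^ 2 * t ^ 2) / (1 - t ^ 2))) volume 0 1 := by
  refine intervalIntegrable_one_div_sqrt_one_sub_sq.mono_fun'
    (Measurable.aestronglyMeasurable (by fun_prop)) ?_
  filter_upwards [ae_restrict_mem measurableSet_uIoc] with t ht
  rw [uIoc_of_le zero_le_one] at ht
  rw [Real.norm_of_nonneg (by positivity)]
  exact ellE_integrand_le hk ht.1.le ht.2

theorem ellK_pos {k : ℝ} (hk : k ^ 2 < 1) : 0 < ellK k := by
  refine intervalIntegral.intervalIntegral_pos_of_pos_on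
    (intervalIntegrable_ellF_integrand hk) (fun t ht => ?_) zero_lt_one
  have hB := one_sub_mul_sq_pos hk ht.1.le ht.2.le
  have hA : 0 < 1 - t ^ 2 := by nlinarith [ht.1, ht.2]
  positivity

theorem ellEc_le_ellK {k : ℝ} (hk : k ^ 2 < 1) : ellEc k ≤ ellK k := by
  refine intervalIntegral.integral_mono_on zero_le_one (intervalIntegrable_ellE_integrand hk)
    (intervalIntegrable_ellF_integrand hk) fun t ht => ?_
  rw [ellE_integrand_eq hk ht.1 ht.2]
  exact mul_le_of_le_one_left (by positivity)
    (by nlinarith [mul_nonneg (sq_nonneg k) (sq_nonneg t)])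

theorem one_sub_sq_mul_ellK_le_ellEc {k : ℝ} (hk : k ^ 2 < 1) :
    (1 - k ^ 2) * ellK k ≤ ellEc k := by
  unfold ellK ellF
  rw [← intervalIntegral.integral_const_mul]
  refine intervalIntegral.integral_mono_on zero_le_one
    ((intervalIntegrable_ellF_integrand hk).const_mul _)
    (intervalIntegrable_ellE_integrand hk) fun t ht => ?_
  rw [ellE_integrand_eq hk ht.1 ht.2]
  have ht2 := pow_le_one₀ (n := 2) ht.1 ht.2
  exact mul_le_mul_of_nonneg_right (by nlinarith [sq_nonneg k]) (by positivity)

theorem one_sub_sq_mul_ellK_le {k : ℝ} (hk : k ^ 2 < 1) :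
    (1 - k ^ 2) * ellK k ≤ √(1 - k ^ 2) * ∫ t in (0:ℝ)..1, 1 / √(1 - t ^ 2) := by
  have h : ellK k ≤ 1 / √(1 - k ^ 2) * ∫ t in (0:ℝ)..1, 1 / √(1 - t ^ 2) := by
    rw [← intervalIntegral.integral_const_mul]
    exact intervalIntegral.integral_mono_on zero_le_one (intervalIntegrable_ellF_integrand hk)
      (intervalIntegrable_one_div_sqrt_one_sub_sq.const_mul _)
      fun t ht => ellF_integrand_le hk ht.1 ht.2
  have hm : 0 < 1 - k ^ 2 := by linarith
  calc (1 - k ^ 2) * ellK k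
      ≤ (1 - k ^ 2) * (1 / √(1 - k ^ 2) * ∫ t in (0:ℝ)..1, 1 / √(1 - t ^ 2)) := by gcongr
    _ = √(1 - k ^ 2) * ∫ t in (0:ℝ)..1, 1 / √(1 - t ^ 2) := by
      rw [← mul_assoc, mul_one_div, Real.div_sqrt]

theorem eventually_sq_lt_one_nhdsLT : ∀ᶠ k : ℝ in 𝓝[<] 1, k ^ 2 < 1 := by
  filter_upwards [Ioo_mem_nhdsLT (show (0:ℝ) < 1 by norm_num)] with k hk
  nlinarith [hk.1, hk.2]

theorem tendsto_ellEc_nhdsLT_one : Tendsto ellEc (𝓝[<] 1) (𝓝 1) := by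
  have key : Tendsto (fun k : ℝ => ∫ t in (0:ℝ)..1, √((1 - k ^ 2 * t ^ 2) / (1 - t ^ 2)))
      (𝓝[<] 1) (𝓝 (∫ _ in (0:ℝ)..1, (1:ℝ))) := by
    refine intervalIntegral.tendsto_integral_filter_of_dominated_convergence
      (fun t => 1 / √(1 - t ^ 2))
      (Eventually.of_forall fun k => Measurable.aestronglyMeasurable (by fun_prop)) ?_
      intervalIntegrable_one_div_sqrt_one_sub_sq ?_
    · filter_upwards [eventually_sq_lt_one_nhdsLT] with k hk
      refine Eventually.of_forall fun t ht => ?_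
      rw [uIoc_of_le zero_le_one] at ht
      rw [Real.norm_of_nonneg (by positivity)]
      exact ellE_integrand_le hk ht.1.le ht.2
    · filter_upwards [compl_mem_ae_iff.2 (measure_singleton (1:ℝ))] with t ht1 ht
      rw [uIoc_of_le zero_le_one] at ht
      have hlt : t < 1 := lt_of_le_of_ne ht.2 ht1
      have hA : 1 - t ^ 2 ≠ 0 := by nlinarith [ht.1]
      have hc : Continuous fun k : ℝ => √((1 - k ^ 2 * t ^ 2) / (1 - t ^ 2)) := by fun_prop
      have := hc.tendsto 1
      simp only [one_pow, one_mul, div_self hA, Real.sqrt_one] at this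
      exact this.mono_left nhdsWithin_le_nhds
  simpa only [intervalIntegral.integral_const, sub_zero, smul_eq_mul, mul_one] using! key

/-- `E(k) − (1 − E'(k)/K'(k)) K(k) → 1` as `k → 1⁻`. -/
theorem stmt_16 :
    Tendsto (fun k : ℝ => ellEc k - (1 - ellE' k / ellK' k) * ellK k)
      (nhdsWithin 1 (Set.Iio 1)) (nhds 1) := by
  have hsmall : Tendsto (fun k : ℝ => (1 - ellE' k / ellK' k) * ellK k) (𝓝[<] 1) (𝓝 0) := by
    have hbound : Tendsto (fun k : ℝ => √(1 - k ^ 2) * ∫ t in (0:ℝ)..1, 1 / √(1 - t ^ 2))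
        (𝓝[<] 1) (𝓝 0) := by
      have hc : Continuous fun k : ℝ =>
          √(1 - k ^ 2) * ∫ t in (0:ℝ)..1, 1 / √(1 - t ^ 2) := by fun_prop
      have := hc.tendsto 1
      simp only [one_pow, sub_self, Real.sqrt_zero, zero_mul] at this
      exact this.mono_left nhdsWithin_le_nhds
    have hpos : ∀ᶠ k : ℝ in 𝓝[<] 1, 0 < k :=
      nhdsWithin_le_nhds (lt_mem_nhds zero_lt_one)
    refine tendsto_of_tendsto_of_tendsto_of_le_of_le' tendsto_const_nhds hbound ?_ ?_
    all_goals
      filter_upwards [eventually_sq_lt_one_nhdsLT, hpos] with k hk hk0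
      have hsq : √(1 - k ^ 2) ^ 2 = 1 - k ^ 2 := Real.sq_sqrt (by linarith)
      have hk' : √(1 - k ^ 2) ^ 2 < 1 := by rw [hsq]; nlinarith
      have hK' : 0 < ellK' k := ellK_pos hk'
    · have h : ellE' k / ellK' k ≤ 1 := (div_le_one hK').2 (ellEc_le_ellK hk')
      exact mul_nonneg (by linarith) (ellK_pos hk).le
    · have h : 1 - (1 - k ^ 2) ≤ ellE' k / ellK' k := by
        rw [le_div_iff₀ hK', ← hsq]
        exact one_sub_sq_mul_ellK_le_ellEc hk'
      exact (mul_le_mul_of_nonneg_right (by linarith) (ellK_pos hk).le).trans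
        (one_sub_sq_mul_ellK_le hk)
  simpa using tendsto_ellEc_nhdsLT_one.sub hsmall
end
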